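/- Let K be a field of characteristic 0, and let n ≥ 2 and 1 ≤ r < n. For i ∈ I(n,r−1) and z ∈ ℤ, let i⌢z ∈ I(ℤ,r) denote the r-tuple obtained by appending z to i. Then the unital K-subalgebra of End_K(Ẽ^{⊗r}) generated by the set X = {ξ_{i⌢s, i⌢(s+1)} : i ∈ I(n,r−1), s ∈ {1,…,n}} ∪ {ξ_{i⌢s, i⌢(s−1)} : i ∈ I(n,r−1), s ∈ {1,…,n}} equals the centralizer algebra End_{KΣ̂_r}(Ẽ^{⊗r}). (This is the key step showing that, for r < n, the universal enveloping algebra of the affine special linear Lie algebra maps onto the affine Schur algebra S̃(n,r).) -/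

import Mathlib

noncomputable section

namespace AffineSchur

variable (K : Type*) [Field K] (n r : ℕ)

/-- The right action of the pair `(σ,ε) ∈ Σ̂_r = Σ_r ⋉ ℤ^r` on `I(ℤ,r)`:
`i·(σ,ε) = i∘σ + n·ε`. -/
def act (σ : Equiv.Perm (Fin r)) (ε : Fin r → ℤ) (i : Fin r → ℤ) : Fin r → ℤ :=
  fun k => i (σ k) + n * ε k

/-- The tensor space `Ẽ^{⊗r}`: the free `K`-module with basis `(v_i)_{i ∈ I(ℤ,r)}`. -/
abbrev TensorSpace := (Fin r → ℤ) →₀ K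

/-- The right-translation operator `T_{σ,ε} : v_i ↦ v_{i·(σ,ε)}`. -/
def transOp (σ : Equiv.Perm (Fin r)) (ε : Fin r → ℤ) :
    Module.End K (TensorSpace K r) :=
  Finsupp.lmapDomain K K (act n r σ ε)

/-- The finite set `{k : (k,l) lies in the Σ̂_r-orbit of (i,j)}`. -/
def xiSupport (i j l : Fin r → ℤ) : Finset (Fin r → ℤ) := by
  classical
  exact (Finset.univ.filter fun σ : Equiv.Perm (Fin r) =>
      ∀ k, (n : ℤ) ∣ (l k - j (σ k))).image
    fun σ => fun k => i (σ k) + (l k - j (σ k))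

/-- The operator `ξ_{i,j} ∈ End_K(Ẽ^{⊗r})` given by
`ξ_{i,j}(v_l) = Σ_{k : (k,l) in the Σ̂_r-orbit of (i,j)} v_k`. -/
def xi (i j : Fin r → ℤ) : Module.End K (TensorSpace K r) :=
  Finsupp.lsum K fun l => LinearMap.toSpanSingleton K _
    (∑ k ∈ xiSupport n r i j l, Finsupp.single k (1 : K))

/-- The centralizer algebra `End_{KΣ̂_r}(Ẽ^{⊗r})` of all the translation operators
`T_{σ,ε}` inside `End_K(Ẽ^{⊗r})` — the affine Schur algebra `S̃(n,r)`. -/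
def affineSchur : Subalgebra K (Module.End K (TensorSpace K r)) :=
  Subalgebra.centralizer K
    (Set.range fun p : Equiv.Perm (Fin r) × (Fin r → ℤ) => transOp K n r p.1 p.2)


/-- Appending an integer z to a tuple i ∈ I(ℤ,r−1), giving a tuple in I(ℤ,r)
(z is placed at the last position). -/
def app (i : Fin (r - 1) → ℤ) (z : ℤ) : Fin r → ℤ :=
  fun k => if h : (k : ℕ) < r - 1 then i ⟨k, h⟩ else z

/-! ### Partial shifts -/

/-- A partial shift of `ℤ`: a domain and a shift amount. -/
@[ext] structure PM where
  dom : Set ℤ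
  sh : ℤ

instance : Mul PM := ⟨fun x y => ⟨{l | l ∈ y.dom ∧ l + y.sh ∈ x.dom}, x.sh + y.sh⟩⟩
instance : One PM := ⟨⟨Set.univ, 0⟩⟩

lemma PM.mul_dom (x y : PM) : (x * y).dom = {l | l ∈ y.dom ∧ l + y.sh ∈ x.dom} := rfl
lemma PM.mul_sh (x y : PM) : (x * y).sh = x.sh + y.sh := rfl
lemma PM.one_dom : (1 : PM).dom = Set.univ := rfl
lemma PM.one_sh : (1 : PM).sh = 0 := rfl

instance : Monoid PM where
  mul_assoc x y z := by
    ext l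
    · simp only [PM.mul_dom, PM.mul_sh, Set.mem_ofPred_eq, and_assoc]
      rw [add_assoc, add_comm z.sh]
    · simp only [PM.mul_sh]; ring
  one_mul x := by ext l <;> simp [PM.mul_dom, PM.mul_sh, PM.one_dom, PM.one_sh]
  mul_one x := by ext l <;> simp [PM.mul_dom, PM.mul_sh, PM.one_dom, PM.one_sh]

variable {K r}

lemma end_ext {f g : Module.End K (TensorSpace K r)}
    (h : ∀ l, f (Finsupp.single l 1) = g (Finsupp.single l 1)) : f = g := by
  refine Finsupp.lhom_ext' fun l => LinearMap.ext_ring ?_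
  simpa using h l

variable (K r)

open Classical in
/-- The tensor operator attached to a tuple of partial shifts. -/
def TT (y : Fin r → PM) : Module.End K (TensorSpace K r) :=
  Finsupp.lsum K fun l => LinearMap.toSpanSingleton K _
    (if ∀ p, l p ∈ (y p).dom then Finsupp.single (fun p => l p + (y p).sh) (1 : K) else 0)

open Classical in
lemma TT_single (y : Fin r → PM) (l : Fin r → ℤ) :
    TT K r y (Finsupp.single l 1) =
      if ∀ p, l p ∈ (y p).dom then Finsupp.single (fun p => l p + (y p).sh) (1 : K) else 0 := by
  simp [TT]

lemma TT_one : TT K r 1 = 1 := by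
  refine end_ext fun l => ?_
  simp [TT_single, PM.one_dom, PM.one_sh]

lemma TT_mul (y z : Fin r → PM) : TT K r (y * z) = TT K r y * TT K r z := by
  classical
  refine end_ext fun l => ?_
  rw [Module.End.mul_apply, TT_single, TT_single]
  by_cases h : ∀ p, l p ∈ (z p).dom
  · rw [if_pos h, TT_single]
    simp only [Pi.mul_apply, PM.mul_dom, PM.mul_sh, Set.mem_ofPred_eq]
    simp only [h, true_and, add_assoc, add_comm (z _).sh]
  · rw [if_neg h, map_zero, if_neg]
    intro h'
    exact h fun p => (h' p).1

/-- The derivation-type operator `Σ_p 1⊗…⊗x⊗…⊗1`. -/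
def DD (x : PM) : Module.End K (TensorSpace K r) := ∑ p, TT K r (Pi.mulSingle p x)

lemma DD_comm (x y : PM) :
    DD K r x * DD K r y + DD K r (y * x) = DD K r y * DD K r x + DD K r (x * y) := by
  simp only [DD, Finset.sum_mul_sum, ← TT_mul]
  conv_rhs => rw [Finset.sum_comm]
  rw [← Finset.sum_add_distrib, ← Finset.sum_add_distrib]
  refine Finset.sum_congr rfl fun p _ => ?_
  rw [← Finset.add_sum_erase _ _ (Finset.mem_univ p)]
  conv_rhs => rw [← Finset.add_sum_erase _ _ (Finset.mem_univ p)]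
  have : ∑ q ∈ Finset.univ.erase p, TT K r (Pi.mulSingle p x * Pi.mulSingle q y) =
      ∑ q ∈ Finset.univ.erase p, TT K r (Pi.mulSingle q y * Pi.mulSingle p x) := by
    refine Finset.sum_congr rfl fun q hq => ?_
    rw [(Pi.mulSingle_commute (f := fun _ : Fin r => PM) (Finset.ne_of_mem_erase hq) y x).eq]
  rw [this, ← Pi.mulSingle_mul, ← Pi.mulSingle_mul]
  abel

/-- Symmetrization. -/
def Sy (y : Fin r → PM) : Module.End K (TensorSpace K r) :=
  ∑ σ : Equiv.Perm (Fin r), TT K r (y ∘ σ)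

lemma Sy_perm (y : Fin r → PM) (τ : Equiv.Perm (Fin r)) : Sy K r (y ∘ τ) = Sy K r y := by
  unfold Sy
  exact Fintype.sum_equiv (Equiv.mulLeft τ) _ _ fun σ => rfl

lemma DD_mul_Sy (x : PM) (y : Fin r → PM) :
    DD K r x * Sy K r y = ∑ q, Sy K r (Pi.mulSingle q x * y) := by
  simp only [DD, Sy, Finset.sum_mul_sum, ← TT_mul]
  rw [Finset.sum_comm, Finset.sum_comm (s := Finset.univ (α := Fin r))]
  refine Finset.sum_congr rfl fun σ _ => ?_
  refine Fintype.sum_equiv σ _ _ fun p => ?_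
  congr 1
  funext q
  simp [Pi.mulSingle_apply]

lemma mem_of_nsmul [CharZero K] {V : Type*} [Semiring V] [Algebra K V] (B : Subalgebra K V)
    (N : ℕ) (hN : N ≠ 0) (v : V) (h : N • v ∈ B) : v ∈ B := by
  have : v = (N : K)⁻¹ • (N • v) := by
    rw [← Nat.cast_smul_eq_nsmul K, smul_smul, inv_mul_cancel₀ (by exact_mod_cast hN), one_smul]
  rw [this]
  exact B.smul_mem h _

lemma mem_of_add {V : Type*} [Semiring V] [Algebra K V] (B : Subalgebra K V)
    {a b c : V} (ha : a ∈ B) (hc : c ∈ B) (h : a = b + c) : b ∈ B := by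
  have : b = a + (-1 : K) • c := by
    have h0 : c + (-1 : K) • c = 0 := by
      nth_rewrite 1 [← one_smul K c]
      rw [← add_smul, add_neg_cancel, zero_smul]
    rw [h, add_assoc, h0, add_zero]
  rw [this]
  exact B.add_mem ha (B.smul_mem hc _)

lemma Sy_mem [CharZero K] (B : Subalgebra K (Module.End K (TensorSpace K r))) (C : Submonoid PM)
    (hC : ∀ x ∈ C, DD K r x ∈ B) (m : ℕ) : ∀ y : Fin r → PM, (∀ p, y p ∈ C) →
      {p | y p ≠ 1}.ncard ≤ m → Sy K r y ∈ B := by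
  classical
  induction m with
  | zero =>
    intro y _ hm
    have h0 : {p | y p ≠ 1} = ∅ := by
      rw [← Set.ncard_eq_zero (Set.toFinite _)]; omega
    have : y = 1 := by
      funext p
      by_contra h
      have : p ∈ ({p | y p ≠ 1} : Set (Fin r)) := h
      rw [h0] at this
      exact this
    subst this
    unfold Sy
    refine B.sum_mem fun σ _ => ?_
    have : (1 : Fin r → PM) ∘ σ = 1 := rfl
    rw [this, TT_one]
    exact B.one_mem
  | succ m ih =>
    intro y hy hm
    by_cases hs : ∃ p0, y p0 ≠ 1
    swap
    · push Not at hs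
      refine ih y hy ?_
      have : {p | y p ≠ 1} = (∅ : Set (Fin r)) := by ext p; simp [hs p]
      rw [this]; simp
    obtain ⟨p0, hp0⟩ := hs
    set y' := Function.update y p0 1 with hy'
    have hy'C : ∀ p, y' p ∈ C := by
      intro p
      by_cases h : p = p0
      · subst h; simp [hy', C.one_mem]
      · simp [hy', h, hy p]
    have hcard : {p | y' p ≠ 1}.ncard ≤ m := by
      have hlt : {p | y' p ≠ 1}.ncard < {p | y p ≠ 1}.ncard := by
        refine Set.ncard_lt_ncard ?_ (Set.toFinite _)
        refine Set.ssubset_iff_of_subset ?_ |>.2 ⟨p0, hp0, by simp [hy']⟩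
        intro p hp
        by_cases h : p = p0
        · subst h; exact hp0
        · simpa [hy', h] using hp
      omega
    have key := DD_mul_Sy K r (y p0) y'
    rw [← Finset.sum_filter_add_sum_filter_not Finset.univ (fun q => y' q = 1)] at key
    have h1 : ∀ q ∈ Finset.univ.filter (fun q => y' q = 1),
        Sy K r (Pi.mulSingle q (y p0) * y') = Sy K r y := by
      intro q hq
      rw [← Sy_perm K r y (Equiv.swap p0 q)]
      congr 1
      have hq1 : y' q = 1 := by simpa using hq
      funext p
      by_cases hpq : p = q
      · subst hpq
        simp [hq1]
      by_cases hp : p = p0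
      · subst hp
        have : y q = 1 := by
          rw [hy', Function.update_of_ne (Ne.symm hpq)] at hq1
          exact hq1
        simp [hy', hpq, this]
      · simp [hy', hpq, hp, Equiv.swap_apply_of_ne_of_ne hp hpq]
    rw [Finset.sum_congr rfl h1, Finset.sum_const] at key
    refine mem_of_nsmul K B (Finset.univ.filter (fun q => y' q = 1)).card ?_ _ ?_
    · rw [Finset.card_ne_zero]
      exact ⟨p0, by simp [hy']⟩
    · refine mem_of_add K B (B.mul_mem (hC _ (hy p0)) (ih y' hy'C hcard))
        (B.sum_mem fun q hq => ?_) key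
      have hq1 : y' q ≠ 1 := by simpa using hq
      refine ih _ (fun p => ?_) (le_trans (Set.ncard_le_ncard ?_ (Set.toFinite _)) hcard)
      · rw [Pi.mul_apply]
        refine C.mul_mem ?_ (hy'C p)
        rw [Pi.mulSingle_apply]
        split_ifs
        · exact hy p0
        · exact C.one_mem
      · intro p hp
        by_cases hpq : p = q
        · subst hpq; exact hq1
        · simpa [hpq] using hp

/-! ### Matrix units -/

/-- The matrix unit: defined on the residue class `b`, shifting by `d`. -/
def ee (b : ZMod n) (d : ℤ) : PM := ⟨{l | (l : ZMod n) = b}, d⟩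

/-- An empty partial shift. -/
def zz (d : ℤ) : PM := ⟨∅, d⟩

lemma ee_mul (b b' : ZMod n) (d d' : ℤ) :
    ee n b d * ee n b' d' = if b' + (d' : ZMod n) = b then ee n b' (d + d') else zz (d + d') := by
  split_ifs with h
  · ext l
    · simp only [ee, PM.mul_dom, Set.mem_ofPred_eq, Int.cast_add, ← h]
      constructor
      · exact fun h => h.1
      · intro h; simp [h]
    · rfl
  · ext l
    · simp only [ee, zz, PM.mul_dom, Set.mem_ofPred_eq, Int.cast_add, Set.mem_empty_iff_false,
        iff_false]
      rintro ⟨h1, h2⟩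
      exact h (h1 ▸ h2)
    · rfl

lemma DD_zz (d : ℤ) : DD K r (zz d) = 0 := by
  refine Finset.sum_eq_zero fun p _ => end_ext fun l => ?_
  rw [TT_single, if_neg]
  · simp
  · intro h
    simpa [zz] using h p

/-- The operators for matrix units. -/
def D (b : ZMod n) (d : ℤ) : Module.End K (TensorSpace K r) := DD K r (ee n b d)

lemma D_comm (b b' : ZMod n) (d d' : ℤ) :
    D K n r b d * D K n r b' d' + (if b + (d : ZMod n) = b' then D K n r b (d + d') else 0) =
      D K n r b' d' * D K n r b d +
        (if b' + (d' : ZMod n) = b then D K n r b' (d + d') else 0) := by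
  have h := DD_comm K r (ee n b d) (ee n b' d')
  rw [ee_mul, ee_mul, add_comm d' d] at h
  unfold D
  split_ifs at h ⊢ <;> simpa [DD_zz] using h

lemma D_single (b : ZMod n) (d : ℤ) (l : Fin r → ℤ) :
    D K n r b d (Finsupp.single l 1) =
      ∑ p, if (l p : ZMod n) = b then Finsupp.single (Function.update l p (l p + d)) (1 : K)
        else 0 := by
  classical
  rw [D, DD, LinearMap.sum_apply]
  refine Finset.sum_congr rfl fun p _ => ?_
  rw [TT_single]
  have h1 : (∀ q, l q ∈ ((Pi.mulSingle p (ee n b d) : Fin r → PM) q).dom) ↔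
      (l p : ZMod n) = b := by
    constructor
    · intro h
      simpa [ee] using h p
    · intro h q
      by_cases hq : q = p
      · subst hq; simpa [ee] using h
      · simp [hq, PM.one_dom]
  simp only [h1]
  congr 2
  funext q
  by_cases hq : q = p
  · subst hq; simp [ee]
  · simp [hq, PM.one_sh]

/-! ### Weights -/

/-- The multiset of residues. -/
def wt (l : Fin r → ℤ) : Multiset (ZMod n) := Finset.univ.val.map fun p => (l p : ZMod n)

/-- The weight idempotent. -/
def W (μ : Multiset (ZMod n)) : Module.End K (TensorSpace K r) :=
  Finsupp.lsum K fun l => LinearMap.toSpanSingleton K _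
    (if wt n r l = μ then Finsupp.single l (1 : K) else 0)

lemma W_single (μ : Multiset (ZMod n)) (l : Fin r → ℤ) :
    W K n r μ (Finsupp.single l 1) = if wt n r l = μ then Finsupp.single l (1 : K) else 0 := by
  simp [W]

lemma wt_eq_iff (l j : Fin r → ℤ) : wt n r l = wt n r j ↔
    ∃ σ : Equiv.Perm (Fin r), ∀ k, (l k : ZMod n) = j (σ k) := by
  classical
  constructor
  · intro h
    have hc : ∀ c : ZMod n, Nonempty ({p // (l p : ZMod n) = c} ≃ {p // (j p : ZMod n) = c}) := by
      intro c
      rw [← Fintype.card_eq, Fintype.card_subtype, Fintype.card_subtype]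
      have h1 := congrArg (Multiset.count c) h
      simp only [wt, Multiset.count_map, eq_comm (a := c)] at h1
      exact h1
    exact ⟨Equiv.ofFiberEquiv fun c => (hc c).some,
      fun k => (Equiv.ofFiberEquiv_map (fun c => (hc c).some) k).symm⟩
  · rintro ⟨σ, h⟩
    unfold wt
    simp only [h]
    have := Multiset.map_univ_val_equiv σ
    conv_rhs => rw [← this, Multiset.map_map]
    rfl

lemma D_mul_W_of_notMem (b : ZMod n) (d : ℤ) (μ : Multiset (ZMod n)) (h : b ∉ μ) :
    D K n r b d * W K n r μ = 0 := by
  refine end_ext fun l => ?_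
  rw [Module.End.mul_apply, W_single]
  split_ifs with hl
  · rw [D_single]
    refine Finset.sum_eq_zero fun p _ => if_neg ?_
    rintro rfl
    apply h
    rw [← hl]
    exact Multiset.mem_map.2 ⟨p, by simp, rfl⟩
  · simp

lemma D_zero_mul_W (b : ZMod n) (μ : Multiset (ZMod n)) :
    D K n r b 0 * W K n r μ = (μ.count b) • W K n r μ := by
  refine end_ext fun l => ?_
  rw [Module.End.mul_apply, LinearMap.smul_apply, W_single]
  split_ifs with hl
  · rw [D_single]
    simp only [add_zero, Function.update_eq_self]
    rw [← Finset.sum_filter, Finset.sum_const, ← hl, wt, Multiset.count_map]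
    congr 1
    rw [Finset.card_def]
    congr 1
    ext
    simp [eq_comm]
  · simp

/-- All weights. -/
def wts [NeZero n] : Finset (Multiset (ZMod n)) :=
  Finset.univ.image fun f : Fin r → ZMod n => Finset.univ.val.map f

lemma sum_W [NeZero n] : ∑ μ ∈ wts n r, W K n r μ = 1 := by
  refine end_ext fun l => ?_
  rw [LinearMap.sum_apply]
  simp only [W_single]
  rw [Finset.sum_ite_eq, if_pos]
  · rfl
  · exact Finset.mem_image.2 ⟨fun p => (l p : ZMod n), by simp, rfl⟩

lemma card_of_mem_wts [NeZero n] {μ : Multiset (ZMod n)} (h : μ ∈ wts n r) : μ.card = r := by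
  obtain ⟨f, -, rfl⟩ := Finset.mem_image.1 h
  simp

lemma mem_of_mul_W [NeZero n] (B : Subalgebra K (Module.End K (TensorSpace K r)))
    (f : Module.End K (TensorSpace K r)) (h : ∀ μ ∈ wts n r, f * W K n r μ ∈ B) : f ∈ B := by
  have : f = ∑ μ ∈ wts n r, f * W K n r μ := by
    rw [← Finset.mul_sum, sum_W, mul_one]
  rw [this]
  exact B.sum_mem h

lemma exists_notMem [NeZero n] (hrn : r < n) {μ : Multiset (ZMod n)} (h : μ ∈ wts n r) :
    ∃ c, c ∉ μ := by
  by_contra! hc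
  have h1 : (Finset.univ : Finset (ZMod n)).val ≤ μ :=
    (Multiset.le_iff_subset Finset.univ.nodup).2 fun c _ => hc c
  have h2 := Multiset.card_le_card h1
  rw [card_of_mem_wts n r h] at h2
  simp [ZMod.card] at h2
  omega

lemma exists_step [NeZero n] (hr : 1 ≤ r) (hrn : r < n) {μ : Multiset (ZMod n)}
    (h : μ ∈ wts n r) : ∃ b, b ∈ μ ∧ b - 1 ∉ μ := by
  by_contra! hc
  obtain ⟨c, hcμ⟩ := exists_notMem n r hrn h
  obtain ⟨b, hb⟩ : ∃ b, b ∈ μ := by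
    apply Multiset.exists_mem_of_ne_zero
    rintro rfl
    have := card_of_mem_wts n r h
    simp at this
    omega
  have hk : ∀ k : ℕ, b - k ∈ μ := by
    intro k
    induction k with
    | zero => simpa using hb
    | succ k ih =>
      have := hc _ ih
      rwa [sub_sub, ← Nat.cast_succ] at this
  apply hcμ
  have := hk (b - c).val
  rwa [ZMod.natCast_zmod_val, sub_sub_cancel] at this

section gen
variable [CharZero K] [NeZero n] (hr : 1 ≤ r) (hrn : r < n)
  (B : Subalgebra K (Module.End K (TensorSpace K r)))
  (hp : ∀ b, ∀ μ, D K n r b 1 * W K n r μ ∈ B)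
  (hm : ∀ b, ∀ μ, D K n r b (-1) * W K n r μ ∈ B)

lemma W_mem (hr : 1 ≤ r) (hrn : r < n) (B : Subalgebra K (Module.End K (TensorSpace K r)))
    (hp : ∀ b, ∀ μ, D K n r b 1 * W K n r μ ∈ B)
    (hm : ∀ b, ∀ μ, D K n r b (-1) * W K n r μ ∈ B)
    {μ : Multiset (ZMod n)} (h : μ ∈ wts n r) : W K n r μ ∈ B := by
  obtain ⟨b, hb, hb1⟩ := exists_step n r hr hrn h
  have hD : D K n r (b - 1) 1 ∈ B := mem_of_mul_W K n r B _ fun ν _ => hp _ ν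
  have key := congrArg (· * W K n r μ) (D_comm K n r (b - 1) b 1 (-1))
  simp only [Int.cast_neg, Int.cast_one, sub_add_cancel, ← sub_eq_add_neg, if_true, sub_self,
    add_mul, mul_assoc, D_mul_W_of_notMem K n r (b - 1) _ μ hb1, D_zero_mul_W, mul_zero,
    zero_add, add_zero] at key
  refine mem_of_nsmul K B (μ.count b) (by rwa [Multiset.count_ne_zero]) _ ?_
  rw [← key]
  exact B.mul_mem hD (hm _ _)

lemma D_mem_aux (hrn : r < n) (B : Subalgebra K (Module.End K (TensorSpace K r)))
    (hW : ∀ μ ∈ wts n r, W K n r μ ∈ B) (u : ℤ) (hu : u * u = 1)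
    (h1 : ∀ b, D K n r b u ∈ B) (d : ℕ) : ∀ b, D K n r b (u * d) ∈ B := by
  induction d using Nat.strong_induction_on with
  | _ d ih =>
  intro b
  have huz : (u : ZMod n) * u = 1 := by exact_mod_cast congrArg (Int.cast : ℤ → ZMod n) hu
  rcases Nat.eq_zero_or_pos d with rfl | hd
  · refine mem_of_mul_W K n r B _ fun μ hμ => ?_
    simp only [Nat.cast_zero, mul_zero, D_zero_mul_W]
    exact B.nsmul_mem (hW μ hμ) _
  by_cases hdn : (d : ZMod n) = 0
  · refine mem_of_mul_W K n r B _ fun μ hμ => ?_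
    obtain ⟨c, hc⟩ := exists_notMem n r hrn hμ
    by_cases hcb : c = b
    · subst hcb
      rw [D_mul_W_of_notMem K n r c _ μ hc]
      exact B.zero_mem
    have hnd : n ≤ d := Nat.le_of_dvd hd ((ZMod.natCast_eq_zero_iff d n).1 hdn)
    obtain ⟨e, he⟩ : ∃ e : ℕ, e = (u * (c - b) : ZMod n).val := ⟨_, rfl⟩
    have hez : (e : ZMod n) = u * (c - b) := by rw [he, ZMod.natCast_zmod_val]
    have hen : e < n := he ▸ ZMod.val_lt _
    have he0 : e ≠ 0 := by
      rintro rfl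
      apply hcb
      have : (u : ZMod n) * (u * (c - b)) = 0 := by rw [← hez]; simp
      rw [← mul_assoc, huz, one_mul] at this
      exact sub_eq_zero.1 this
    have hbe : b + (u : ZMod n) * e = c := by
      rw [hez, ← mul_assoc, huz]; ring
    have key := congrArg (· * W K n r μ) (D_comm K n r c b (u * (d - e : ℕ)) (u * e))
    have hsum : u * ((d - e : ℕ) : ℤ) + u * e = u * d := by
      rw [← mul_add, ← Nat.cast_add, Nat.sub_add_cancel (by omega)]
    rw [hsum] at key
    simp only [add_mul, ite_mul, mul_assoc, zero_mul, D_mul_W_of_notMem K n r c _ μ hc, mul_zero,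
      ite_self, add_zero, zero_add, Int.cast_mul, Int.cast_natCast, hbe, if_true] at key
    rw [← key]
    exact B.mul_mem (ih _ (by omega) c) (B.mul_mem (ih _ (by omega) b) (hW μ hμ))
  · obtain ⟨e, rfl⟩ : ∃ e, d = e + 1 := ⟨d - 1, by omega⟩
    have key := D_comm K n r (b + u * e) b u (u * e)
    have hpos : b + ((u * (e : ℤ) : ℤ) : ZMod n) = b + u * e := by simp
    rw [if_neg, if_pos hpos, add_zero] at key
    · have : u + u * (e : ℤ) = u * ((e + 1 : ℕ) : ℤ) := by push_cast; ring
      rw [this] at key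
      have key := key.trans (add_comm _ _)
      have hE := ih e (by omega) b
      exact mem_of_add K B (B.mul_mem (h1 _) hE) (B.mul_mem hE (h1 _)) key
    · intro h
      apply hdn
      have h2 : (u : ZMod n) * ((e + 1 : ℕ) : ZMod n) = 0 := by
        push_cast
        linear_combination h
      have : (u : ZMod n) * (u * ((e + 1 : ℕ) : ZMod n)) = 0 := by rw [h2, mul_zero]
      rwa [← mul_assoc, huz, one_mul] at this

lemma D_mem (hr : 1 ≤ r) (hrn : r < n) (B : Subalgebra K (Module.End K (TensorSpace K r)))
    (hp : ∀ b, ∀ μ, D K n r b 1 * W K n r μ ∈ B)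
    (hm : ∀ b, ∀ μ, D K n r b (-1) * W K n r μ ∈ B) (b : ZMod n) (d : ℤ) : D K n r b d ∈ B := by
  have hW : ∀ μ ∈ wts n r, W K n r μ ∈ B := fun μ h => W_mem K n r hr hrn B hp hm h
  rcases Int.eq_nat_or_neg d with ⟨k, rfl | rfl⟩
  · simpa using D_mem_aux K n r hrn B hW 1 (by simp)
      (fun b => mem_of_mul_W K n r B _ fun ν _ => hp _ ν) k b
  · simpa using D_mem_aux K n r hrn B hW (-1) (by simp)
      (fun b => mem_of_mul_W K n r B _ fun ν _ => hm _ ν) k b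

end gen

/-- The submonoid of partial shifts generated by the matrix units. -/
def CC : Submonoid PM where
  carrier := {x | x = 1 ∨ (∃ d, x = zz d) ∨ ∃ b d, x = ee n b d}
  one_mem' := Or.inl rfl
  mul_mem' := by
    have hz : ∀ (x : PM) d, x * zz d = zz (x.sh + d) := by
      intro x d; ext l <;> simp [PM.mul_dom, PM.mul_sh, zz]
    have hz' : ∀ (x : PM) d, zz d * x = zz (d + x.sh) := by
      intro x d; ext l <;> simp [PM.mul_dom, PM.mul_sh, zz]
    rintro x y (rfl | ⟨d, rfl⟩ | ⟨b, d, rfl⟩) hy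
    · simpa using hy
    · exact Or.inr (Or.inl ⟨_, hz' _ _⟩)
    · rcases hy with (rfl | ⟨d, rfl⟩ | ⟨b, d, rfl⟩)
      · exact Or.inr (Or.inr ⟨b, d, mul_one _⟩)
      · exact Or.inr (Or.inl ⟨_, hz _ _⟩)
      · rw [ee_mul]
        split_ifs
        · exact Or.inr (Or.inr ⟨_, _, rfl⟩)
        · exact Or.inr (Or.inl ⟨_, rfl⟩)

lemma Sy_ee_mem [CharZero K] (B : Subalgebra K (Module.End K (TensorSpace K r)))
    (hD : ∀ b d, D K n r b d ∈ B) (b : Fin r → ZMod n) (d : Fin r → ℤ) :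
    Sy K r (fun p => ee n (b p) (d p)) ∈ B := by
  refine Sy_mem K r B (CC n) ?_ _ _ (fun p => Or.inr (Or.inr ⟨_, _, rfl⟩)) le_rfl
  rintro x (rfl | ⟨d, rfl⟩ | ⟨b, d, rfl⟩)
  · refine B.sum_mem fun p _ => ?_
    rw [Pi.mulSingle_one, TT_one]
    exact B.one_mem
  · rw [DD_zz]; exact B.zero_mem
  · exact hD b d

/-! ### The centralizer -/

lemma transOp_single (σ : Equiv.Perm (Fin r)) (ε : Fin r → ℤ) (l : Fin r → ℤ) (c : K) :
    transOp K n r σ ε (Finsupp.single l c) = Finsupp.single (act n r σ ε l) c := by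
  simp [transOp]

lemma transOp_conj_TT (σ : Equiv.Perm (Fin r)) (y : Fin r → PM) :
    transOp K n r σ 0 * TT K r y * transOp K n r σ⁻¹ 0 = TT K r (y ∘ σ) := by
  classical
  refine end_ext fun l => ?_
  rw [Module.End.mul_apply, Module.End.mul_apply, transOp_single, TT_single, TT_single]
  have h1 : (∀ p, act n r σ⁻¹ 0 l p ∈ (y p).dom) ↔ ∀ p, l p ∈ ((y ∘ σ) p).dom := by
    constructor
    · intro h p
      simpa [act] using h (σ p)
    · intro h p
      simpa [act] using h (σ⁻¹ p)
  simp only [h1]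
  split_ifs
  · rw [transOp_single]
    congr 1
    funext p
    simp [act]
  · simp

lemma mem_of_centralizer [CharZero K] [NeZero n]
    (B : Subalgebra K (Module.End K (TensorSpace K r)))
    (hD : ∀ b d, D K n r b d ∈ B) (f : Module.End K (TensorSpace K r))
    (hf : ∀ σ ε, transOp K n r σ ε * f = f * transOp K n r σ ε) : f ∈ B := by
  classical
  let J : (Fin r → ZMod n) → (Fin r → ℤ) := fun g p => ((g p).val : ℤ)
  have hJ : ∀ g p, ((J g p : ℤ) : ZMod n) = g p := by intro g p; simp [J]
  have hfe : f = ∑ g : Fin r → ZMod n, ∑ i ∈ (f (Finsupp.single (J g) 1)).support,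
      (f (Finsupp.single (J g) 1)) i • TT K r (fun p => ee n (g p) (i p - J g p)) := by
    refine end_ext fun l => ?_
    simp only [LinearMap.sum_apply, LinearMap.smul_apply, TT_single]
    rw [Finset.sum_eq_single (fun p => (l p : ZMod n))]
    · set g : Fin r → ZMod n := fun p => (l p : ZMod n) with hg
      have hdvd : ∀ p, (n : ℤ) ∣ l p - J g p := by
        intro p
        rw [← ZMod.intCast_eq_intCast_iff_dvd_sub, hJ]
      choose ε hε using hdvd
      have hl : act n r 1 ε (J g) = l := by
        funext p
        simp only [act, Equiv.Perm.one_apply]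
        rw [← hε]; ring
      have h2 : f (Finsupp.single l 1) = transOp K n r 1 ε (f (Finsupp.single (J g) 1)) := by
        rw [← Module.End.mul_apply, hf, Module.End.mul_apply, transOp_single, hl]
      rw [h2]
      conv_lhs => rw [← Finsupp.sum_single (f (Finsupp.single (J g) 1)), Finsupp.sum, map_sum]
      refine Finset.sum_congr rfl fun i _ => ?_
      rw [transOp_single, if_pos (fun p => by simp [ee, hg]), Finsupp.smul_single, smul_eq_mul,
        mul_one]
      congr 1
      funext p
      simp only [act, Equiv.Perm.one_apply, ee]
      rw [← hε]; ring
    · intro g _ hg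
      refine Finset.sum_eq_zero fun i _ => ?_
      rw [if_neg, smul_zero]
      intro h
      apply hg
      funext p
      exact (h p).symm
    · simp
  have hav : (Fintype.card (Equiv.Perm (Fin r))) • f =
      ∑ σ : Equiv.Perm (Fin r), transOp K n r σ 0 * f * transOp K n r σ⁻¹ 0 := by
    rw [← Finset.card_univ, ← Finset.sum_const]
    refine Finset.sum_congr rfl fun σ _ => ?_
    rw [hf, mul_assoc]
    have : transOp K n r σ 0 * transOp K n r σ⁻¹ 0 = 1 := by
      refine end_ext fun l => ?_
      rw [Module.End.mul_apply, transOp_single, transOp_single, Module.End.one_apply]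
      congr 1
      funext p
      simp [act]
    rw [this, mul_one]
  refine mem_of_nsmul K B (Fintype.card (Equiv.Perm (Fin r))) Fintype.card_ne_zero f ?_
  rw [hav]
  have : ∑ σ : Equiv.Perm (Fin r), transOp K n r σ 0 * f * transOp K n r σ⁻¹ 0 =
      ∑ g : Fin r → ZMod n, ∑ i ∈ (f (Finsupp.single (J g) 1)).support,
      (f (Finsupp.single (J g) 1)) i • Sy K r (fun p => ee n (g p) (i p - J g p)) := by
    conv_lhs =>
      enter [2, σ]
      rw [hfe]
    simp only [Finset.mul_sum, Finset.sum_mul, mul_smul_comm, smul_mul_assoc, transOp_conj_TT]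
    rw [Finset.sum_comm]
    refine Finset.sum_congr rfl fun g _ => ?_
    rw [Finset.sum_comm]
    refine Finset.sum_congr rfl fun i _ => ?_
    rw [Sy, Finset.smul_sum]
  rw [this]
  exact B.sum_mem fun g _ => B.sum_mem fun i _ => B.smul_mem (Sy_ee_mem K n r B hD _ _) _

lemma wt_act (σ : Equiv.Perm (Fin r)) (ε l : Fin r → ℤ) :
    wt n r (act n r σ ε l) = wt n r l := by
  rw [wt_eq_iff]
  exact ⟨σ, fun k => by simp [act]⟩

lemma W_comm (σ : Equiv.Perm (Fin r)) (ε : Fin r → ℤ) (μ : Multiset (ZMod n)) :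
    transOp K n r σ ε * W K n r μ = W K n r μ * transOp K n r σ ε := by
  refine end_ext fun l => ?_
  rw [Module.End.mul_apply, Module.End.mul_apply, transOp_single, W_single, W_single, wt_act]
  split_ifs
  · rw [transOp_single]
  · simp

lemma D_comm_trans (σ : Equiv.Perm (Fin r)) (ε : Fin r → ℤ) (b : ZMod n) (d : ℤ) :
    transOp K n r σ ε * D K n r b d = D K n r b d * transOp K n r σ ε := by
  refine end_ext fun l => ?_
  rw [Module.End.mul_apply, Module.End.mul_apply, transOp_single, D_single, D_single, map_sum]
  symm
  refine Fintype.sum_equiv σ _ _ fun p => ?_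
  have : ((act n r σ ε l p : ℤ) : ZMod n) = l (σ p) := by simp [act]
  rw [this]
  split_ifs
  · rw [transOp_single]
    congr 1
    funext q
    by_cases hq : q = p
    · subst hq; simp [act]; ring
    · simp [act, hq]
  · simp

/-! ### The generators -/

lemma xi_single (i j l : Fin r → ℤ) : xi K n r i j (Finsupp.single l 1) =
    ∑ k ∈ xiSupport n r i j l, Finsupp.single k (1 : K) := by
  simp [xi]

lemma xi_app (hr : 1 ≤ r) (i : Fin (r - 1) → ℤ) (s z : ℤ) (hsz : s ≠ z) :
    xi K n r (app r i s) (app r i z) =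
      D K n r (z : ZMod n) (s - z) * W K n r (wt n r (app r i z)) := by
  classical
  let L : Fin r := ⟨r - 1, by omega⟩
  have hz : ∀ z, app r i z L = z := by intro z; simp [app, L]
  have hne : ∀ k, k ≠ L → app r i s k = app r i z k := by
    intro k hk
    have : (k : ℕ) < r - 1 := by
      have := k.2
      have : (k : ℕ) ≠ r - 1 := fun h => hk (Fin.ext h)
      omega
    simp [app, this]
  refine end_ext fun l => ?_
  rw [xi_single, Module.End.mul_apply, W_single]
  split_ifs with hl
  · obtain ⟨τ, hτ⟩ := (wt_eq_iff n r _ _).1 hl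
    rw [D_single, ← Finset.sum_filter]
    have hsupp : xiSupport n r (app r i s) (app r i z) l =
        (Finset.univ.filter fun p => (l p : ZMod n) = z).image
          (fun p => Function.update l p (l p + (s - z))) := by
      have hform : ∀ σ : Equiv.Perm (Fin r), ∀ p, σ p = L →
          (fun k => app r i s (σ k) + (l k - app r i z (σ k))) =
            Function.update l p (l p + (s - z)) := by
        intro σ p hp
        funext k
        by_cases hk : k = p
        · subst hk
          rw [hp, hz, hz, Function.update_self]; ring
        · rw [Function.update_of_ne hk, hne]
          · ring
          · rw [← hp]; exact fun h => hk (σ.injective h)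
      ext k
      simp only [xiSupport, Finset.mem_image, Finset.mem_filter, Finset.mem_univ, true_and,
        ← ZMod.intCast_eq_intCast_iff_dvd_sub]
      constructor
      · rintro ⟨σ, hσ, rfl⟩
        refine ⟨σ⁻¹ L, ?_, (hform σ _ (by simp)).symm⟩
        rw [← hσ]; simp [hz]
      · rintro ⟨p, hp, rfl⟩
        refine ⟨Equiv.swap p (τ⁻¹ L) |>.trans τ, ?_, hform _ _ (by simp)⟩
        intro k
        by_cases h1 : k = p
        · subst h1
          simp [hz, hp]
        by_cases h2 : k = τ⁻¹ L
        · subst h2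
          have := hτ (τ⁻¹ L)
          rw [show τ (τ⁻¹ L) = L by simp, hz] at this
          simp only [Equiv.trans_apply, Equiv.swap_apply_right]
          rw [← hτ, hp, this]
        · simp only [Equiv.trans_apply, Equiv.swap_apply_of_ne_of_ne h1 h2]
          exact (hτ k).symm
    rw [hsupp, Finset.sum_image]
    intro p _ q _ hpq
    by_contra hne
    have := congrFun hpq p
    simp only [Function.update_self, Function.update_of_ne hne] at this
    omega
  · rw [map_zero]
    apply Finset.sum_eq_zero
    intro k hk
    exfalso
    apply hl
    rw [wt_eq_iff]
    simp only [xiSupport, Finset.mem_image, Finset.mem_filter, Finset.mem_univ, true_and,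
        ← ZMod.intCast_eq_intCast_iff_dvd_sub] at hk
    obtain ⟨σ, hσ, -⟩ := hk
    exact ⟨σ, fun k => (hσ k).symm⟩

lemma exists_rep [NeZero n] (c : ZMod n) : ∃ t : ℤ, 1 ≤ t ∧ t ≤ n ∧ (t : ZMod n) = c := by
  refine ⟨((c - 1).val : ℤ) + 1, by omega, ?_, by simp⟩
  have := ZMod.val_lt (c - 1)
  omega

/-- Each `D b d * W μ` with `d = ±1` is zero or one of the generators. -/
lemma DW_gen [NeZero n] (hr : 1 ≤ r) (b : ZMod n) (d : ℤ) (hd : d ≠ 0) (μ : Multiset (ZMod n)) :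
    D K n r b d * W K n r μ = 0 ∨ ∃ (i : Fin (r - 1) → ℤ) (s : ℤ),
      (∀ k, 1 ≤ i k ∧ i k ≤ (n : ℤ)) ∧ 1 ≤ s ∧ s ≤ (n : ℤ) ∧
      D K n r b d * W K n r μ = xi K n r (app r i s) (app r i (s - d)) := by
  classical
  by_cases hμ : ∃ l : Fin r → ℤ, wt n r l = μ
  swap
  · left
    have : W K n r μ = 0 := by
      refine end_ext fun l => ?_
      rw [W_single, if_neg (fun h => hμ ⟨l, h⟩)]
      rfl
    rw [this, mul_zero]
  obtain ⟨l, rfl⟩ := hμ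
  by_cases hb : b ∈ wt n r l
  swap
  · exact Or.inl (D_mul_W_of_notMem K n r b d _ hb)
  right
  obtain ⟨p, -, hp⟩ := Multiset.mem_map.1 hb
  let L : Fin r := ⟨r - 1, by omega⟩
  choose t ht1 ht2 ht3 using exists_rep n
  obtain ⟨s, hs⟩ : ∃ s, s = t (b + d) := ⟨_, rfl⟩
  have hsb : ((s - d : ℤ) : ZMod n) = b := by rw [hs]; simp [ht3]
  refine ⟨fun k => t (l (Equiv.swap p L ⟨k, by omega⟩) : ZMod n), s,
    fun k => ⟨ht1 _, ht2 _⟩, hs ▸ ht1 _, hs ▸ ht2 _, ?_⟩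
  rw [xi_app K n r hr _ _ _ (by omega), hsb, sub_sub_cancel]
  congr 2
  rw [wt_eq_iff]
  refine ⟨Equiv.swap p L, fun k => ?_⟩
  by_cases hk : k = p
  · subst hk
    rw [Equiv.swap_apply_left, hp]
    simp only [app, L, lt_irrefl, dite_false]
    exact hsb.symm
  · have hlt : ((Equiv.swap p L k : Fin r) : ℕ) < r - 1 := by
      have h1 := (Equiv.swap p L k).2
      have h2 : ((Equiv.swap p L k : Fin r) : ℕ) ≠ r - 1 := by
        intro h
        apply hk
        have h3 : Equiv.swap p L k = L := Fin.ext h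
        exact (Equiv.swap p L).injective (h3.trans (Equiv.swap_apply_left p L).symm)
      omega
    simp only [app, hlt, dite_true, ht3, Fin.eta, Equiv.swap_apply_self]

/-- over a field of characteristic 0, for n ≥ 2 and 1 ≤ r < n, the unital
K-subalgebra of End_K(Ẽ^{⊗r}) generated by
X = {ξ_{i⌢s, i⌢(s+1)} : i ∈ I(n,r−1), s ∈ {1,…,n}}
  ∪ {ξ_{i⌢s, i⌢(s−1)} : i ∈ I(n,r−1), s ∈ {1,…,n}}
equals the centralizer algebra End_{KΣ̂_r}(Ẽ^{⊗r}) (the affine Schur algebra S̃(n,r)). -/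
theorem adjoin_X_eq_affineSchur (K : Type*) [Field K] [CharZero K]
    (n r : ℕ) (hn : 2 ≤ n) (hr : 1 ≤ r) (hrn : r < n) :
    Algebra.adjoin K
      ({f : Module.End K (TensorSpace K r) |
        ∃ (i : Fin (r - 1) → ℤ) (s : ℤ),
          (∀ k, 1 ≤ i k ∧ i k ≤ (n : ℤ)) ∧ 1 ≤ s ∧ s ≤ (n : ℤ) ∧
          f = xi K n r (app r i s) (app r i (s + 1))} ∪
       {f : Module.End K (TensorSpace K r) |
        ∃ (i : Fin (r - 1) → ℤ) (s : ℤ),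
          (∀ k, 1 ≤ i k ∧ i k ≤ (n : ℤ)) ∧ 1 ≤ s ∧ s ≤ (n : ℤ) ∧
          f = xi K n r (app r i s) (app r i (s - 1))})
    = affineSchur K n r := by
  have : NeZero n := ⟨by omega⟩
  apply le_antisymm
  · rw [Algebra.adjoin_le_iff]
    have hDW : ∀ b d μ, D K n r b d * W K n r μ ∈ affineSchur K n r := by
      intro b d μ
      unfold affineSchur
      refine Subalgebra.mul_mem _ ?_ ?_
      · rw [Subalgebra.mem_centralizer_iff]
        rintro _ ⟨⟨σ, ε⟩, rfl⟩
        exact D_comm_trans K n r σ ε b d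
      · rw [Subalgebra.mem_centralizer_iff]
        rintro _ ⟨⟨σ, ε⟩, rfl⟩
        exact W_comm K n r σ ε μ
    rintro f (⟨i, s, -, -, -, rfl⟩ | ⟨i, s, -, -, -, rfl⟩)
    · rw [xi_app K n r hr _ _ _ (by omega)]
      exact hDW _ _ _
    · rw [xi_app K n r hr _ _ _ (by omega)]
      exact hDW _ _ _
  · intro f hf
    unfold affineSchur at hf
    rw [Subalgebra.mem_centralizer_iff] at hf
    refine mem_of_centralizer K n r _ (D_mem K n r hr hrn _ ?_ ?_) f
      (fun σ ε => hf _ ⟨(σ, ε), rfl⟩)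
    · intro b μ
      rcases DW_gen K n r hr b 1 (by omega) μ with h | ⟨i, s, h1, h2, h3, h4⟩
      · rw [h]; exact Subalgebra.zero_mem _
      · exact Algebra.subset_adjoin (Or.inr ⟨i, s, h1, h2, h3, h4⟩)
    · intro b μ
      rcases DW_gen K n r hr b (-1) (by omega) μ with h | ⟨i, s, h1, h2, h3, h4⟩
      · rw [h]; exact Subalgebra.zero_mem _
      · rw [sub_neg_eq_add] at h4
        exact Algebra.subset_adjoin (Or.inl ⟨i, s, h1, h2, h3, h4⟩)

end AffineSchur
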